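/- If Ĝ is a graph with maximal spectral radius in Bl(k,φ), then Ĝ has at most one block with 4 or more vertices. -/

import Mathlib

namespace SpectralBlock

variable {V : Type*}

open Classical in
/-- The real adjacency matrix of a simple graph. -/
noncomputable def adjMat [Fintype V] (G : SimpleGraph V) : Matrix V V ℝ :=
  Matrix.of fun u v => if G.Adj u v then (1 : ℝ) else 0

/-- The spectral radius of a graph: the largest real eigenvalue of its adjacency matrix. -/
noncomputable def specRad [Fintype V] (G : SimpleGraph V) : ℝ :=
  sSup {r : ℝ | ∃ x : V → ℝ, x ≠ 0 ∧ (adjMat G).mulVec x = r • x}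

/-- A Perron vector of `G`: an entrywise positive eigenvector of the adjacency
matrix for the eigenvalue `specRad G`. -/
def IsPerron [Fintype V] (G : SimpleGraph V) (x : V → ℝ) : Prop :=
  (∀ v, 0 < x v) ∧ (adjMat G).mulVec x = specRad G • x

/-- A dissociation set: a set of vertices inducing a subgraph of maximum degree at most 1. -/
def IsDissoc (G : SimpleGraph V) (D : Set V) : Prop :=
  ∀ v ∈ D, (D ∩ {u | G.Adj v u}).ncard ≤ 1

/-- The dissociation number: the maximum cardinality of a dissociation set. -/
noncomputable def dissocNum [Fintype V] (G : SimpleGraph V) : ℕ :=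
  sSup {n : ℕ | ∃ D : Set V, IsDissoc G D ∧ D.ncard = n}

/-- A maximum dissociation set. -/
def IsMaxDissoc [Fintype V] (G : SimpleGraph V) (D : Set V) : Prop :=
  IsDissoc G D ∧ D.ncard = dissocNum G

/-- A cut vertex of a connected graph: a vertex whose removal disconnects the graph. -/
def IsCutVertex (G : SimpleGraph V) (v : V) : Prop :=
  G.Connected ∧ ¬ ((⊤ : G.Subgraph).deleteVerts {v}).coe.Connected

/-- A block of a graph, viewed as a set of vertices: a maximal set inducing a
connected subgraph having no cut vertex of its own. -/
def IsBlock (G : SimpleGraph V) (B : Set V) : Prop :=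
  (G.induce B).Connected ∧ (∀ v, ¬ IsCutVertex (G.induce B) v) ∧
    ∀ C : Set V, B ⊆ C → (G.induce C).Connected →
      (∀ v, ¬ IsCutVertex (G.induce C) v) → B = C

/-- A pendant block: a block containing at most one cut vertex of the graph. -/
def IsPendantBlock (G : SimpleGraph V) (B : Set V) : Prop :=
  IsBlock G B ∧ {v | v ∈ B ∧ IsCutVertex G v}.Subsingleton

/-- A block graph: a connected graph each of whose blocks is a complete graph. -/
def IsBlockGraph (G : SimpleGraph V) : Prop :=
  G.Connected ∧ ∀ B : Set V, IsBlock G B → B.Pairwise G.Adj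

/-- The class `Bl(k, φ)` of block graphs on `k` vertices with dissociation number `φ`. -/
def memBl (k φ : ℕ) (G : SimpleGraph (Fin k)) : Prop :=
  IsBlockGraph G ∧ dissocNum G = φ

/-- `G` has maximal spectral radius in the class `Bl(k, φ)`. -/
def MaxSpecIn (k φ : ℕ) (G : SimpleGraph (Fin k)) : Prop :=
  memBl k φ G ∧ ∀ H : SimpleGraph (Fin k), memBl k φ H → specRad H ≤ specRad G

section Conn

/-- Walk inside a set. -/
def RW (G : SimpleGraph V) (X : Set V) (a b : V) : Prop :=
  ∃ p : G.Walk a b, ∀ z ∈ p.support, z ∈ X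

lemma RW.symm' {G : SimpleGraph V} {X : Set V} {a b : V} (h : RW G X a b) : RW G X b a := by
  obtain ⟨p, hp⟩ := h
  exact ⟨p.reverse, by simpa using hp⟩

lemma RW.trans' {G : SimpleGraph V} {X : Set V} {a b c : V} (h : RW G X a b) (h' : RW G X b c) :
    RW G X a c := by
  obtain ⟨p, hp⟩ := h
  obtain ⟨q, hq⟩ := h'
  refine ⟨p.append q, fun z hz => ?_⟩
  rw [SimpleGraph.Walk.mem_support_append_iff] at hz
  exact hz.elim (hp z) (hq z)

lemma RW.refl' {G : SimpleGraph V} {X : Set V} {a : V} (h : a ∈ X) : RW G X a a :=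
  ⟨.nil, by simpa using h⟩

lemma RW.single' {G : SimpleGraph V} {X : Set V} {a b : V} (h : a ∈ X) (h' : b ∈ X)
    (hab : G.Adj a b) : RW G X a b :=
  ⟨hab.toWalk, by simp [h, h']⟩

lemma RW.mono' {G : SimpleGraph V} {X Y : Set V} {a b : V} (hXY : X ⊆ Y) (h : RW G X a b) :
    RW G Y a b := by
  obtain ⟨p, hp⟩ := h
  exact ⟨p, fun z hz => hXY (hp z hz)⟩

lemma conn_of_root {G : SimpleGraph V} {X : Set V} {r : V} (hr : r ∈ X)
    (h : ∀ a ∈ X, RW G X r a) : (G.induce X).Connected := by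
  have : Nonempty X := ⟨⟨r, hr⟩⟩
  have key : ∀ a : X, (G.induce X).Reachable ⟨r, hr⟩ a := by
    rintro ⟨a, ha⟩
    obtain ⟨p, hp⟩ := h a ha
    exact ⟨p.induce X hp⟩
  exact ⟨fun a b => (key a).symm.trans (key b)⟩

lemma walk_cross {W : Type*} {H : SimpleGraph W} (Y : Set W) {a b : W} (p : H.Walk a b) :
    a ∈ Y → b ∉ Y → ∃ c d, H.Adj c d ∧ c ∈ Y ∧ d ∉ Y := by
  induction p with
  | nil => intro h h'; exact absurd h h'
  | @cons u v w h p ih =>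
    intro hu hw
    by_cases hv : v ∈ Y
    · exact ih hv hw
    · exact ⟨u, v, h, hu, hv⟩

lemma conn_cross {G : SimpleGraph V} {X : Set V} (h : (G.induce X).Connected) (Y : Set V)
    {a b : V} (ha : a ∈ X) (hb : b ∈ X) (haY : a ∈ Y) (hbY : b ∉ Y) :
    ∃ c ∈ X, ∃ d ∈ X, G.Adj c d ∧ c ∈ Y ∧ d ∉ Y := by
  obtain ⟨p⟩ := h.preconnected ⟨a, ha⟩ ⟨b, hb⟩
  obtain ⟨c, d, h1, h2, h3⟩ := walk_cross (Subtype.val ⁻¹' Y) p haY hbY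
  exact ⟨c, c.2, d, d.2, h1, h2, h3⟩

lemma del_conn_iff (G : SimpleGraph V) (X : Set V) (v : X) :
    ((⊤ : (G.induce X).Subgraph).deleteVerts {v}).coe.Connected ↔
      (G.induce (X \ {v.1})).Connected := by
  let e : ((⊤ : (G.induce X).Subgraph).deleteVerts {v}).coe ≃g (G.induce (X \ {v.1})) :=
    { toFun := fun a => ⟨a.1.1, a.1.2, fun h => a.2.2 (Subtype.ext h)⟩
      invFun := fun a => ⟨⟨a.1, a.2.1⟩, by
        refine ⟨trivial, fun h => a.2.2 ?_⟩
        exact congrArg Subtype.val h⟩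
      left_inv := fun a => rfl
      right_inv := fun a => rfl
      map_rel_iff' := by
        rintro ⟨⟨a, ha⟩, ha'⟩ ⟨⟨b, hb⟩, hb'⟩
        simp only [SimpleGraph.Subgraph.deleteVerts_verts] at ha' hb'
        have h1 : (⟨a, ha⟩ : X) ≠ v := ha'.2
        have h2 : (⟨b, hb⟩ : X) ≠ v := hb'.2
        simp [h1, h2] }
  exact e.connected_iff

/-- Nonseparable vertex set. -/
def NS (G : SimpleGraph V) (X : Set V) : Prop :=
  (G.induce X).Connected ∧ ∀ v ∈ X, (G.induce (X \ {v})).Connected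

lemma ns_iff (G : SimpleGraph V) (X : Set V) :
    NS G X ↔ (G.induce X).Connected ∧ ∀ v, ¬ IsCutVertex (G.induce X) v := by
  unfold NS IsCutVertex
  refine and_congr_right fun h => ?_
  constructor
  · rintro h' v ⟨_, h2⟩
    exact h2 ((del_conn_iff G X v).2 (h' v.1 v.2))
  · intro h' v hv
    by_contra hc
    exact h' ⟨v, hv⟩ ⟨h, fun h3 => hc ((del_conn_iff G X ⟨v, hv⟩).1 h3)⟩

lemma isBlock_iff (G : SimpleGraph V) (B : Set V) :
    IsBlock G B ↔ NS G B ∧ ∀ C, B ⊆ C → NS G C → B = C := by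
  unfold IsBlock
  simp only [ns_iff, and_assoc, and_imp]

lemma ns_clique [Finite V] {G : SimpleGraph V} (hG : IsBlockGraph G) {X : Set V} (hX : NS G X) :
    X.Pairwise G.Adj := by
  obtain ⟨B, hXB, hB⟩ := (Set.toFinite {C : Set V | NS G C}).exists_le_maximal hX
  have : IsBlock G B := (isBlock_iff G B).2 ⟨hB.prop, fun C hBC hC => hB.eq_of_le hC hBC⟩
  exact (hG.2 B this).mono hXB

lemma clique_conn {G : SimpleGraph V} {X : Set V} (hX : X.Pairwise G.Adj) (hne : X.Nonempty) :
    (G.induce X).Connected := by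
  obtain ⟨r, hr⟩ := hne
  refine conn_of_root hr fun a ha => ?_
  by_cases h : r = a
  · subst h; exact RW.refl' hr
  · exact RW.single' hr ha (hX hr ha h)

lemma clique_ns {G : SimpleGraph V} {X : Set V} (hX : X.Pairwise G.Adj) {a b : V} (ha : a ∈ X)
    (hb : b ∈ X) (hab : a ≠ b) : NS G X := by
  refine ⟨clique_conn hX ⟨a, ha⟩, fun v hv => clique_conn (hX.mono Set.sdiff_subset) ?_⟩
  by_cases h : a = v
  · exact ⟨b, hb, fun h' => hab (h.trans h'.symm)⟩
  · exact ⟨a, ha, h⟩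

/-- Two neighbours of `w` joined by a walk avoiding `w` are adjacent. -/
lemma nbr_adj [Finite V] {G : SimpleGraph V} (hG : IsBlockGraph G) {w y y' : V}
    (h1 : G.Adj w y) (h2 : G.Adj w y') (hne : y ≠ y') (h : RW G {w}ᶜ y y') : G.Adj y y' := by
  classical
  obtain ⟨p0, hp0⟩ := h
  set p := p0.bypass with hp
  have hpath : p.IsPath := p0.bypass_isPath
  have hw : ∀ z ∈ p.support, z ≠ w := fun z hz => hp0 z (p0.support_bypass_subset_support hz)
  have hnd := hpath.support_nodup
  set X : Set V := insert w {z | z ∈ p.support} with hXdef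
  have hwX : w ∈ X := Set.mem_insert _ _
  have hpX : ∀ z ∈ p.support, z ∈ X := fun z hz => Set.mem_insert_of_mem _ hz
  have hy := p.start_mem_support
  have hy' := p.end_mem_support
  have htake : ∀ z (hz : z ∈ p.support), ∀ t ∈ (p.takeUntil z hz).support, t ∈ p.support :=
    fun z hz t ht => p.support_takeUntil_subset_support hz ht
  have hdrop : ∀ z (hz : z ∈ p.support), ∀ t ∈ (p.dropUntil z hz).support, t ∈ p.support :=
    fun z hz t ht => p.support_dropUntil_subset_support hz ht
  have hNS : NS G X := by
    constructor
    · refine conn_of_root hwX fun a ha => ?_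
      rcases ha with rfl | ha
      · exact RW.refl' hwX
      · exact (RW.single' hwX (hpX _ hy) h1).trans'
          ⟨p.takeUntil a ha, fun t ht => hpX _ (htake a ha t ht)⟩
    · intro c hc
      by_cases hcw : c = w
      · subst hcw
        refine conn_of_root (r := y) ⟨hpX _ hy, hw _ hy⟩ fun a ha => ?_
        have ha' : a ∈ p.support := by
          rcases ha.1 with h | h
          · exact (ha.2 h).elim
          · exact h
        exact ⟨p.takeUntil a ha', fun t ht => ⟨hpX _ (htake a ha' t ht), hw _ (htake a ha' t ht)⟩⟩
      · refine conn_of_root (r := w) ⟨hwX, fun h => hcw h.symm⟩ fun a ha => ?_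
        have hwm : w ∈ X \ {c} := ⟨hwX, fun h => hcw h.symm⟩
        rcases ha with ⟨rfl | ha, hac⟩
        · exact RW.refl' hwm
        have hac' : a ≠ c := hac
        by_cases hct : c ∈ (p.takeUntil a ha).support
        · have hcd : c ∉ (p.dropUntil a ha).support := by
            intro hcd
            have hs := p.take_spec ha
            rw [← hs, SimpleGraph.Walk.support_append] at hnd
            have hcd' : c ∈ (p.dropUntil a ha).support.tail := by
              rw [← SimpleGraph.Walk.cons_tail_support] at hcd
              rcases List.mem_cons.1 hcd with h | h
              · exact (hac' h.symm).elim
              · exact h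
            exact (List.nodup_append.1 hnd).2.2 c hct c hcd' rfl
          have hsub : ∀ t ∈ (p.dropUntil a ha).support, t ∈ X \ {c} := fun t ht =>
            ⟨hpX _ (hdrop a ha t ht), fun h => hcd (by rw [← Set.mem_singleton_iff.1 h]; exact ht)⟩
          exact (RW.single' hwm (hsub _ (p.dropUntil a ha).end_mem_support) h2).trans'
            (RW.symm' ⟨p.dropUntil a ha, hsub⟩)
        · have hsub : ∀ t ∈ (p.takeUntil a ha).support, t ∈ X \ {c} := fun t ht =>
            ⟨hpX _ (htake a ha t ht), fun h => hct (by rw [← Set.mem_singleton_iff.1 h]; exact ht)⟩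
          exact (RW.single' hwm (hsub _ (p.takeUntil a ha).start_mem_support) h1).trans'
            ⟨p.takeUntil a ha, hsub⟩
  exact ns_clique hG hNS (hpX _ hy) (hpX _ hy') hne

end Conn

section Rooted

/-- Rooted structure of a block graph, with level function `d`. -/
structure RS (G : SimpleGraph V) (d : V → ℕ) : Prop where
  root : ∃ r, d r = 0
  clq : ∀ x y, d x = 0 → d y = 0 → x ≠ y → G.Adj x y
  par : ∀ w, 0 < d w → ∃ p, G.Adj w p ∧ d p < d w ∧ (∀ y, G.Adj w y → d y < d w → y = p) ∧
    (∀ y, G.Adj w y → d y = d w → G.Adj y p)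
  sib : ∀ w y y', 0 < d w → G.Adj w y → G.Adj w y' → d y = d w → d y' = d w → y ≠ y' → G.Adj y y'

lemma RS.isBlockGraph [Finite V] {G : SimpleGraph V} {d : V → ℕ} (h : RS G d) :
    IsBlockGraph G := by
  constructor
  · obtain ⟨r, hr⟩ := h.root
    have : Nonempty V := ⟨r⟩
    have key : ∀ n, ∀ v, d v = n → G.Reachable r v := by
      intro n
      induction n using Nat.strong_induction_on with
      | _ n ih =>
        intro v hv
        rcases Nat.eq_zero_or_pos n with hn | hn
        · by_cases hrv : r = v
          · subst hrv; rfl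
          · exact (h.clq r v hr (hv.trans hn) hrv).reachable
        · obtain ⟨p, hp, hlt, _⟩ := h.par v (hv ▸ hn)
          exact (ih (d p) (hv ▸ hlt) p rfl).trans hp.symm.reachable
    exact ⟨fun a b => (key _ a rfl).symm.trans (key _ b rfl)⟩
  · intro B hB
    have hNS := ((isBlock_iff G B).1 hB).1
    have hne : B.Nonempty := by
      obtain ⟨⟨b, hb⟩⟩ := hNS.1.nonempty
      exact ⟨b, hb⟩
    obtain ⟨w, hwB, hmax⟩ := Set.exists_max_image B d (Set.toFinite B) hne
    rcases Nat.eq_zero_or_pos (d w) with h0 | hpos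
    · intro a ha b hb hab
      have := hmax a ha
      have := hmax b hb
      exact h.clq a b (by omega) (by omega) hab
    obtain ⟨p, hwp, hpd, hpu, hps⟩ := h.par w hpos
    set X : Set V := {y | y = w ∨ (G.Adj w y ∧ d y = d w)} with hX
    have hpX : p ∉ X := by
      rintro (h1 | h1)
      · exact G.ne_of_adj hwp h1.symm
      · omega
    have hXd : ∀ y ∈ X, d y = d w := by
      rintro y (rfl | h1)
      · rfl
      · exact h1.2
    have hXp : ∀ y ∈ X, G.Adj y p := by
      rintro y (rfl | h1)
      · exact hwp
      · exact hps y h1.1 h1.2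
    have hXn : ∀ y ∈ X, ∀ b ∈ B, G.Adj y b → b ∉ X → b = p := by
      intro y hy b hb hyb hbX
      have hyd := hXd y hy
      have hbd := hmax b hb
      rcases lt_or_eq_of_le hbd with hlt | heq
      · obtain ⟨p', _, _, hpu', _⟩ := h.par y (by omega)
        rw [hpu' b hyb (by omega), hpu' p (hXp y hy) (by omega)]
      · exfalso
        apply hbX
        rcases hy with rfl | hy
        · exact Or.inr ⟨hyb, heq⟩
        · by_cases hbw : b = w
          · exact Or.inl hbw
          · exact Or.inr ⟨(h.sib y b w (by omega) hyb hy.1.symm (by omega) (by omega) hbw).symm, heq⟩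
    have hsub : ∀ z ∈ B, z ∈ X ∨ z = p := by
      intro z hz
      by_contra hcon
      push Not at hcon
      have hwX : w ∈ X := Or.inl rfl
      by_cases hpB : p ∈ B
      · obtain ⟨c, hc, e, he, hadj, hcX, heX⟩ := conn_cross (hNS.2 p hpB) X (a := w) (b := z)
          ⟨hwB, (G.ne_of_adj hwp)⟩ ⟨hz, hcon.2⟩ hwX hcon.1
        exact he.2 (hXn c hcX e he.1 hadj heX)
      · obtain ⟨c, hc, e, he, hadj, hcX, heX⟩ := conn_cross hNS.1 X hwB hz hwX hcon.1
        exact hpB (hXn c hcX e he hadj heX ▸ he)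
    intro a ha b hb hab
    rcases hsub a ha with haX | rfl <;> rcases hsub b hb with hbX | rfl
    · rcases haX with rfl | ha2 <;> rcases hbX with rfl | hb2
      · exact (hab rfl).elim
      · exact hb2.1
      · exact ha2.1.symm
      · exact h.sib w a b hpos ha2.1 hb2.1 ha2.2 hb2.2 hab
    · exact hXp a haX
    · exact (hXp b hbX).symm
    · exact (hab rfl).elim

/-- Distance to a set. -/
noncomputable def dS (G : SimpleGraph V) (S : Set V) (v : V) : ℕ :=
  sInf {n | ∃ s ∈ S, ∃ p : G.Walk v s, p.length = n}

lemma dS_le {G : SimpleGraph V} {S : Set V} {v s : V} (hs : s ∈ S) (p : G.Walk v s) :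
    dS G S v ≤ p.length := Nat.sInf_le ⟨s, hs, p, rfl⟩

lemma dS_spec {G : SimpleGraph V} (hG : G.Connected) {S : Set V} (hS : S.Nonempty) (v : V) :
    ∃ s ∈ S, ∃ p : G.Walk v s, p.length = dS G S v := by
  obtain ⟨s, hs⟩ := hS
  obtain ⟨p⟩ := hG.preconnected v s
  exact Nat.sInf_mem (s := {n | ∃ s ∈ S, ∃ p : G.Walk v s, p.length = n}) ⟨_, s, hs, p, rfl⟩

lemma dS_zero {G : SimpleGraph V} (hG : G.Connected) {S : Set V} (hS : S.Nonempty) (v : V) :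
    dS G S v = 0 ↔ v ∈ S := by
  constructor
  · intro h
    obtain ⟨s, hs, p, hp⟩ := dS_spec hG hS v
    rw [h] at hp
    rw [SimpleGraph.Walk.eq_of_length_eq_zero hp]
    exact hs
  · intro h
    have := dS_le h (SimpleGraph.Walk.nil : G.Walk v v)
    simpa using this

lemma dS_adj {G : SimpleGraph V} (hG : G.Connected) {S : Set V} (hS : S.Nonempty) {v u : V}
    (h : G.Adj v u) : dS G S v ≤ dS G S u + 1 := by
  obtain ⟨s, hs, p, hp⟩ := dS_spec hG hS u
  have := dS_le hs (SimpleGraph.Walk.cons h p)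
  simpa [hp] using this

lemma dS_desc {G : SimpleGraph V} (hG : G.Connected) {S : Set V} (hS : S.Nonempty) {v : V}
    (h : 0 < dS G S v) : ∃ p, G.Adj v p ∧ dS G S p + 1 = dS G S v := by
  obtain ⟨s, hs, p, hp⟩ := dS_spec hG hS v
  cases p with
  | nil => simp at hp; omega
  | @cons _ u _ ha q =>
    refine ⟨u, ha, ?_⟩
    have h1 := dS_le hs q
    have h2 := dS_adj hG hS ha
    simp at hp
    omega

lemma dS_RW {G : SimpleGraph V} (hG : G.Connected) {S : Set V} (hS : S.Nonempty) (w : V) :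
    ∀ n, ∀ y, dS G S y = n → y ≠ w → dS G S y ≤ dS G S w → ∃ s ∈ S, RW G {w}ᶜ y s := by
  intro n
  induction n with
  | zero =>
    intro y hy hne _
    exact ⟨y, (dS_zero hG hS y).1 hy, RW.refl' hne⟩
  | succ n ih =>
    intro y hy hne hle
    obtain ⟨p, hp, hpd⟩ := dS_desc hG hS (v := y) (by omega)
    have hpw : p ≠ w := by rintro rfl; omega
    obtain ⟨s, hs, hr⟩ := ih p (by omega) hpw (by omega)
    exact ⟨s, hs, (RW.single' (X := {w}ᶜ) hne hpw hp).trans' hr⟩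

lemma dS_RW2 {G : SimpleGraph V} (hG : G.Connected) {S : Set V} (hS : S.Nonempty)
    (hclq : S.Pairwise G.Adj) {w y y' : V} (hw : 0 < dS G S w) (hy : y ≠ w) (hy' : y' ≠ w)
    (hd : dS G S y ≤ dS G S w) (hd' : dS G S y' ≤ dS G S w) : RW G {w}ᶜ y y' := by
  have hwS : ∀ s ∈ S, s ≠ w := by
    rintro s hs rfl
    have := (dS_zero hG hS s).2 hs
    omega
  obtain ⟨s, hs, h1⟩ := dS_RW hG hS w _ y rfl hy hd
  obtain ⟨s', hs', h2⟩ := dS_RW hG hS w _ y' rfl hy' hd'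
  refine (h1.trans' ?_).trans' h2.symm'
  by_cases hss : s = s'
  · subst hss; exact RW.refl' (hwS s hs)
  · exact RW.single' (X := {w}ᶜ) (hwS s hs) (hwS s' hs') (hclq hs hs' hss)

lemma rs_of_block [Finite V] {G : SimpleGraph V} (hG : IsBlockGraph G) {S : Set V}
    (hS : S.Nonempty) (hclq : S.Pairwise G.Adj)
    (hmax : ∀ v, v ∉ S → ∃ s ∈ S, ¬ G.Adj v s) : RS G (dS G S) := by
  have hc := hG.1
  have hall : ∀ w y y', 0 < dS G S w → G.Adj w y → G.Adj w y' → dS G S y ≤ dS G S w →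
      dS G S y' ≤ dS G S w → y ≠ y' → G.Adj y y' := by
    intro w y y' hw h1 h2 hd hd' hne
    exact nbr_adj hG h1 h2 hne (dS_RW2 hc hS hclq hw h1.ne' h2.ne' hd hd')
  constructor
  · obtain ⟨r, hr⟩ := hS
    exact ⟨r, (dS_zero hc ⟨r, hr⟩ r).2 hr⟩
  · intro x y hx hy hne
    exact hclq ((dS_zero hc hS x).1 hx) ((dS_zero hc hS y).1 hy) hne
  · intro w hw
    obtain ⟨p, hp, hpd⟩ := dS_desc hc hS hw
    refine ⟨p, hp, by omega, ?_, ?_⟩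
    · intro p' hp' hd'
      by_contra hne
      have hd'' := dS_adj hc hS hp'
      have hpp : G.Adj p' p := hall w p' p hw hp' hp (by omega) (by omega) hne
      rcases Nat.eq_zero_or_pos (dS G S p) with h0 | hpos
      · have hpS := (dS_zero hc hS p).1 h0
        have hpS' := (dS_zero hc hS p').1 (by omega)
        have hwS : w ∉ S := fun h => by
          have := (dS_zero hc hS w).2 h
          omega
        obtain ⟨s, hs, hns⟩ := hmax w hwS
        have hsp : s ≠ p := by rintro rfl; exact hns hp
        have hsp' : s ≠ p' := by rintro rfl; exact hns hp'
        have hws : w ≠ s := by rintro rfl; exact hwS hs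
        refine hns (nbr_adj hG hp.symm (hclq hpS hs hsp.symm) hws ?_)
        exact (RW.single' (X := {p}ᶜ) hp.ne hne hp').trans'
          (RW.single' (X := {p}ᶜ) hne hsp (hclq hpS' hs hsp'.symm))
      · obtain ⟨g, hg, hgd⟩ := dS_desc hc hS hpos
        have hwg : w ≠ g := by rintro rfl; omega
        have : G.Adj w g := by
          refine nbr_adj hG hp.symm hg hwg ?_
          exact (RW.single' (X := {p}ᶜ) hp.ne hne hp').trans'
            (dS_RW2 hc hS hclq hpos hne hg.ne' (by omega) (by omega))
        have := dS_adj hc hS this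
        omega
    · intro y hy hyd
      exact hall w y p hw hy hp (by omega) (by omega) (by rintro rfl; omega)
  · intro w y y' hw h1 h2 hd hd' hne
    exact hall w y y' hw h1 h2 hd.le hd'.le hne

/-- Move the vertices of `S` into the root clique. -/
def mv (G : SimpleGraph V) (d : V → ℕ) (S : Set V) : SimpleGraph V where
  Adj x y := x ≠ y ∧ ((x ∈ S ∧ y ∈ S) ∨ (x ∉ S ∧ y ∉ S ∧ G.Adj x y) ∨
    (x ∈ S ∧ y ∉ S ∧ G.Adj x y ∧ d x < d y) ∨ (x ∉ S ∧ y ∈ S ∧ G.Adj x y ∧ d y < d x))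
  symm := ⟨by
    intro x y h
    have := G.adj_comm x y
    have := h.1.symm
    tauto⟩
  loopless := ⟨by rintro x ⟨h, _⟩; exact h rfl⟩

lemma mv_adj (G : SimpleGraph V) (d : V → ℕ) (S : Set V) (x y : V) : (mv G d S).Adj x y ↔
    x ≠ y ∧ ((x ∈ S ∧ y ∈ S) ∨ (x ∉ S ∧ y ∉ S ∧ G.Adj x y) ∨
    (x ∈ S ∧ y ∉ S ∧ G.Adj x y ∧ d x < d y) ∨ (x ∉ S ∧ y ∈ S ∧ G.Adj x y ∧ d y < d x)) := Iff.rfl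

lemma mv_rs {G : SimpleGraph V} {d : V → ℕ} (h : RS G d) {S : Set V} (hS : ∀ v, d v = 0 → v ∈ S) :
    ∃ d', RS (mv G d S) d' := by
  classical
  refine ⟨fun v => if v ∈ S then 0 else d v, ?_⟩
  have h0 : ∀ v, (if v ∈ S then 0 else d v) = 0 ↔ v ∈ S := by
    intro v
    split_ifs with hv
    · simp [hv]
    · simp only [hv, iff_false]; exact fun h' => hv (hS v h')
  have hpos : ∀ v, 0 < (if v ∈ S then 0 else d v) → v ∉ S ∧ 0 < d v := by
    intro v hv
    split_ifs at hv with h'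
    · omega
    · exact ⟨h', hv⟩
  constructor
  · obtain ⟨r, hr⟩ := h.root
    exact ⟨r, (h0 r).2 (hS r hr)⟩
  · intro x y hx hy hne
    exact ⟨hne, Or.inl ⟨(h0 x).1 hx, (h0 y).1 hy⟩⟩
  · intro w hw
    obtain ⟨hwS, hwd⟩ := hpos w hw
    obtain ⟨p, hp, hlt, hu, hs⟩ := h.par w hwd
    have := G.ne_of_adj hp
    refine ⟨p, ?_, ?_, ?_, ?_⟩
    · rw [mv_adj]; tauto
    · simp only [hwS, if_false]; split_ifs <;> omega
    · intro y hy hyd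
      rw [mv_adj] at hy
      simp only [hwS, if_false] at hyd
      by_cases hyS : y ∈ S
      · exact hu y (by tauto) (by tauto)
      · simp only [hyS, if_false] at hyd
        exact hu y (by tauto) hyd
    · intro y hy hyd
      rw [mv_adj] at hy
      simp only [hwS, if_false] at hyd
      by_cases hyS : y ∈ S
      · simp only [hyS, if_true] at hyd; omega
      · simp only [hyS, if_false] at hyd
        have hyp := hs y (by tauto) hyd
        rw [mv_adj]
        have := G.ne_of_adj hyp
        have : d p < d y := by omega
        tauto
  · intro w y y' hw hy hy' hyd hyd' hne
    obtain ⟨hwS, hwd⟩ := hpos w hw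
    rw [mv_adj] at hy hy'
    simp only [hwS, if_false] at hyd hyd'
    have hyS : y ∉ S := fun h' => by simp only [h', if_true] at hyd; omega
    have hyS' : y' ∉ S := fun h' => by simp only [h', if_true] at hyd'; omega
    simp only [hyS, hyS', if_false] at hyd hyd'
    have := h.sib w y y' hwd (by tauto) (by tauto) hyd hyd' hne
    rw [mv_adj]
    tauto

end Rooted

section Spec

open Matrix

variable [Fintype V]

lemma adjMat_nonneg (G : SimpleGraph V) (a b : V) : 0 ≤ adjMat G a b := by
  unfold adjMat
  simp only [Matrix.of_apply]
  split_ifs <;> norm_num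

lemma adjMat_symm (G : SimpleGraph V) (a b : V) : adjMat G a b = adjMat G b a := by
  unfold adjMat
  by_cases h : G.Adj a b
  · simp [h, h.symm]
  · have hba : ¬ G.Adj b a := fun h2 => h h2.symm
    simp [h, hba]

/-- Quadratic form of the adjacency matrix. -/
noncomputable def qf (G : SimpleGraph V) (x : V → ℝ) : ℝ := ∑ a, ∑ b, adjMat G a b * (x a * x b)

lemma qf_eq (G : SimpleGraph V) (x : V → ℝ) : x ⬝ᵥ (adjMat G *ᵥ x) = qf G x := by
  simp only [qf, dotProduct, mulVec, Finset.mul_sum]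
  refine Finset.sum_congr rfl fun a _ => Finset.sum_congr rfl fun b _ => ?_
  ring

lemma spec_exists [Nonempty V] (G : SimpleGraph V) :
    ∃ y : V → ℝ, (∀ v, 0 ≤ y v) ∧ y ≠ 0 ∧ adjMat G *ᵥ y = specRad G • y ∧
      ∀ z, qf G z ≤ specRad G * (z ⬝ᵥ z) := by
  classical
  let K : Set (V → ℝ) := {x | x ⬝ᵥ x = 1}
  have hK : IsCompact K := by
    refine (isCompact_Icc (a := fun _ : V => (-1 : ℝ)) (b := fun _ => 1)).of_isClosed_subset ?_ ?_
    · exact isClosed_eq (by unfold dotProduct; fun_prop) continuous_const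
    · intro x hx
      have : ∀ i, x i * x i ≤ 1 := by
        intro i
        rw [← show x ⬝ᵥ x = 1 from hx]
        exact Finset.single_le_sum (f := fun i => x i * x i) (fun j _ => mul_self_nonneg _)
          (Finset.mem_univ i)
      exact ⟨fun i => by have := this i; show -1 ≤ x i; nlinarith,
        fun i => by have := this i; show x i ≤ 1; nlinarith⟩
  have hne : K.Nonempty := by
    obtain ⟨v⟩ := ‹Nonempty V›
    exact ⟨Pi.single v 1, by simp [K]⟩
  obtain ⟨x, hxK, hx⟩ := hK.exists_isMaxOn hne (f := qf G)
    (by unfold qf; fun_prop)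
  set M := qf G x with hM
  have hxK' : x ⬝ᵥ x = 1 := hxK
  have hscale : ∀ (c : ℝ) z, qf G (c • z) = c * c * qf G z := by
    intro c z
    simp only [qf, Finset.mul_sum, Pi.smul_apply, smul_eq_mul]
    refine Finset.sum_congr rfl fun a _ => Finset.sum_congr rfl fun b _ => ?_
    ring
  have hle : ∀ z, qf G z ≤ M * (z ⬝ᵥ z) := by
    intro z
    by_cases hz : z = 0
    · subst hz; simp [qf]
    · have hpos : 0 < z ⬝ᵥ z := by
        have h0 : 0 ≤ z ⬝ᵥ z := Finset.sum_nonneg fun i _ => mul_self_nonneg _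
        refine lt_of_le_of_ne h0 fun h => hz ?_
        exact dotProduct_self_eq_zero.1 h.symm
      set c := (Real.sqrt (z ⬝ᵥ z))⁻¹ with hc
      have hcc : c * c * (z ⬝ᵥ z) = 1 := by
        have := Real.mul_self_sqrt hpos.le
        rw [hc, ← mul_inv, this, inv_mul_cancel₀ hpos.ne']
      have hmem : c • z ∈ K := by
        show (c • z) ⬝ᵥ (c • z) = 1
        simp only [smul_dotProduct, dotProduct_smul, smul_eq_mul]
        rw [← hcc]; ring
      have h1 : qf G (c • z) ≤ M := hx hmem
      rw [hscale] at h1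
      calc qf G z = (c * c * (z ⬝ᵥ z)) * qf G z := by rw [hcc, one_mul]
        _ = (c * c * qf G z) * (z ⬝ᵥ z) := by ring
        _ ≤ M * (z ⬝ᵥ z) := by gcongr
  set y : V → ℝ := fun v => |x v| with hy
  have hyy : y ⬝ᵥ y = 1 := by
    rw [← hxK']
    simp [dotProduct, hy]
  have hqy : qf G y = M := by
    apply le_antisymm
    · have := hle y; rwa [hyy, mul_one] at this
    · rw [hM]
      unfold qf
      refine Finset.sum_le_sum fun a _ => Finset.sum_le_sum fun b _ => ?_
      refine mul_le_mul_of_nonneg_left ?_ (adjMat_nonneg G a b)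
      rw [hy, ← abs_mul]
      exact le_abs_self _
  have hy0 : y ≠ 0 := by
    intro h
    rw [h] at hyy
    simp at hyy
  have hdot : ∀ z, z ⬝ᵥ ((M • (1 : Matrix V V ℝ) - adjMat G) *ᵥ z) = M * (z ⬝ᵥ z) - qf G z := by
    intro z
    rw [sub_mulVec, dotProduct_sub, qf_eq, smul_mulVec, one_mulVec, dotProduct_smul, smul_eq_mul]
  have hpsd : (M • (1 : Matrix V V ℝ) - adjMat G).PosSemidef := by
    refine Matrix.PosSemidef.of_dotProduct_mulVec_nonneg ?_ ?_
    · ext a b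
      simp only [conjTranspose_apply, Matrix.sub_apply, Matrix.smul_apply, star_trivial]
      rw [adjMat_symm G b a, one_apply, one_apply]
      simp [eq_comm]
    · intro z
      have := hdot z
      simp only [star_trivial]
      rw [this]
      linarith [hle z]
  have heig : adjMat G *ᵥ y = M • y := by
    have := (hpsd.dotProduct_mulVec_zero_iff y).1 (by
      simp only [star_trivial]
      rw [hdot, hyy, hqy]; ring)
    rw [sub_mulVec, smul_mulVec, one_mulVec, sub_eq_zero] at this
    exact this.symm
  have hspec : specRad G = M := by
    unfold specRad
    apply le_antisymm
    · refine csSup_le ⟨M, y, hy0, heig⟩ ?_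
      rintro r ⟨z, hz, hzr⟩
      have h1 := hle z
      rw [← qf_eq, hzr, dotProduct_smul, smul_eq_mul] at h1
      have hpos : 0 < z ⬝ᵥ z := by
        have h0 : 0 ≤ z ⬝ᵥ z := Finset.sum_nonneg fun i _ => mul_self_nonneg _
        refine lt_of_le_of_ne h0 fun h => hz ?_
        exact dotProduct_self_eq_zero.1 h.symm
      exact le_of_mul_le_mul_right h1 hpos
    · refine le_csSup ⟨M, ?_⟩ ⟨y, hy0, heig⟩
      rintro r ⟨z, hz, hzr⟩
      have h1 := hle z
      rw [← qf_eq, hzr, dotProduct_smul, smul_eq_mul] at h1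
      have hpos : 0 < z ⬝ᵥ z := by
        have h0 : 0 ≤ z ⬝ᵥ z := Finset.sum_nonneg fun i _ => mul_self_nonneg _
        refine lt_of_le_of_ne h0 fun h => hz ?_
        exact dotProduct_self_eq_zero.1 h.symm
      exact le_of_mul_le_mul_right h1 hpos
  exact ⟨y, fun v => abs_nonneg _, hy0, by rw [hspec]; exact heig, by rw [hspec]; exact hle⟩

lemma perron {G : SimpleGraph V} (hG : G.Connected) :
    ∃ y : V → ℝ, (∀ v, 0 < y v) ∧ qf G y = specRad G * (y ⬝ᵥ y) := by
  have := hG.nonempty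
  obtain ⟨y, hy, hy0, heig, -⟩ := spec_exists G
  refine ⟨y, ?_, by rw [← qf_eq, heig, dotProduct_smul, smul_eq_mul]⟩
  have hstep : ∀ a b, G.Adj a b → y a = 0 → y b = 0 := by
    intro a b hab ha
    have h1 := congrFun heig a
    simp only [mulVec, dotProduct, Pi.smul_apply, smul_eq_mul, ha, mul_zero] at h1
    have h2 := (Finset.sum_eq_zero_iff_of_nonneg
      (fun i _ => mul_nonneg (adjMat_nonneg G a i) (hy i))).1 h1 b (Finset.mem_univ b)
    simpa [adjMat, hab] using h2
  intro v
  refine lt_of_le_of_ne (hy v) fun hv => hy0 ?_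
  ext u
  obtain ⟨p⟩ := hG.preconnected v u
  by_contra hu
  obtain ⟨c, d, hcd, hc, hd⟩ := walk_cross {z | y z = 0} p hv.symm hu
  exact hd (hstep c d hcd hc)

lemma specRad_lt {G H : SimpleGraph V} {x : V → ℝ} [Nonempty V]
    (hG : qf G x = specRad G * (x ⬝ᵥ x)) (h : qf G x < qf H x) : specRad G < specRad H := by
  obtain ⟨_, -, -, -, hH⟩ := spec_exists H
  have h1 := hH x
  rw [hG] at h
  have h2 : 0 ≤ x ⬝ᵥ x := Finset.sum_nonneg fun i _ => mul_self_nonneg _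
  exact lt_of_mul_lt_mul_right (h.trans_le h1) h2

lemma qf_lt {G H : SimpleGraph V} {x : V → ℝ} (w : V) (hx : 0 < x w)
    (hag : ∀ a b, a ≠ w → b ≠ w → (G.Adj a b ↔ H.Adj a b))
    (hlt : ∑ b, adjMat G w b * x b < ∑ b, adjMat H w b * x b) : qf G x < qf H x := by
  classical
  set D : V → V → ℝ := fun a b => adjMat H a b - adjMat G a b with hD
  have hDs : ∀ a b, D a b = D b a := fun a b => by
    simp only [hD]; rw [adjMat_symm H, adjMat_symm G]
  have hDw : D w w = 0 := by simp [hD, adjMat]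
  have hD0 : ∀ a b, a ≠ w → b ≠ w → D a b = 0 := by
    intro a b ha hb
    simp [hD, adjMat, hag a b ha hb]
  have hsplit : ∀ a b, D a b * (x a * x b) =
      (if a = w then D w b * x b * x w else 0) + (if b = w then D w a * x a * x w else 0) := by
    intro a b
    by_cases ha : a = w
    · subst ha
      by_cases hb : b = a
      · subst hb; simp [hDw]
      · simp [hb]; ring
    · by_cases hb : b = w
      · subst hb
        simp [ha, hDs a b]; ring
      · simp [ha, hb, hD0 a b ha hb]
  have hdiff : qf H x - qf G x = 2 * x w * ∑ b, D w b * x b := by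
    have h1 : qf H x - qf G x = ∑ a, ∑ b, D a b * (x a * x b) := by
      unfold qf
      rw [← Finset.sum_sub_distrib]
      refine Finset.sum_congr rfl fun a _ => ?_
      rw [← Finset.sum_sub_distrib]
      refine Finset.sum_congr rfl fun b _ => ?_
      simp only [hD]; ring
    rw [h1]
    simp only [hsplit, Finset.sum_add_distrib]
    rw [Finset.sum_comm]
    simp only [Finset.sum_ite_eq', Finset.mem_univ, if_true]
    rw [← Finset.sum_mul]; ring
  have h2 : ∑ b, D w b * x b = ∑ b, adjMat H w b * x b - ∑ b, adjMat G w b * x b := by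
    rw [← Finset.sum_sub_distrib]
    refine Finset.sum_congr rfl fun b _ => ?_
    simp only [hD]; ring
  have h3 : 0 < 2 * x w * ∑ b, D w b * x b := by
    rw [h2]
    have := sub_pos.2 hlt
    positivity
  linarith

end Spec

section Diss

variable [Fintype V]

lemma dissoc_le {G : SimpleGraph V} {D : Set V} (h : IsDissoc G D) : D.ncard ≤ dissocNum G := by
  refine le_csSup ⟨Fintype.card V, ?_⟩ ⟨D, h, rfl⟩
  rintro n ⟨E, -, rfl⟩
  rw [← Nat.card_eq_fintype_card]
  exact Set.ncard_le_card E

lemma dissoc_exists (G : SimpleGraph V) : ∃ D, IsDissoc G D ∧ D.ncard = dissocNum G := by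
  refine Nat.sSup_mem (s := {n : ℕ | ∃ D : Set V, IsDissoc G D ∧ D.ncard = n})
    ⟨0, ∅, by simp [IsDissoc], by simp⟩ ⟨Fintype.card V, ?_⟩
  rintro n ⟨E, -, rfl⟩
  rw [← Nat.card_eq_fintype_card]
  exact Set.ncard_le_card E

lemma dissoc_of_agree {G H : SimpleGraph V} {D E : Set V} (hE : E ⊆ D)
    (hag : ∀ a ∈ E, ∀ b ∈ E, H.Adj a b → G.Adj a b) (h : IsDissoc G D) : IsDissoc H E := by
  intro v hv
  refine le_trans (Set.ncard_le_ncard ?_ (Set.toFinite _)) (h v (hE hv))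
  rintro u ⟨hu, hu2⟩
  exact ⟨hE hu, hag v hv u hu hu2⟩

lemma dissocNum_step {G H : SimpleGraph V} (w : V)
    (hag : ∀ a b, a ≠ w → b ≠ w → (G.Adj a b ↔ H.Adj a b)) :
    dissocNum G ≤ dissocNum H + 1 := by
  obtain ⟨D, hD, hc⟩ := dissoc_exists G
  have h1 : IsDissoc H (D \ {w}) := dissoc_of_agree Set.sdiff_subset
    (fun a ha b hb h => (hag a b ha.2 hb.2).2 h) hD
  have h2 := dissoc_le h1
  have h3 : D.ncard ≤ (D \ {w}).ncard + 1 := by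
    simpa using Set.ncard_le_ncard_sdiff_add_ncard D {w} (Set.toFinite _)
  omega

lemma dissocNum_anti {G H : SimpleGraph V} (h : G ≤ H) : dissocNum H ≤ dissocNum G := by
  obtain ⟨D, hD, hc⟩ := dissoc_exists H
  rw [← hc]
  exact dissoc_le (dissoc_of_agree (fun _ h => h) (fun a _ b _ hab => h hab) hD)

lemma dissoc_clique {G : SimpleGraph V} {D B : Set V} (h : IsDissoc G D)
    (hB : B.Pairwise G.Adj) : (D ∩ B).ncard ≤ 2 := by
  by_cases hne : (D ∩ B).Nonempty
  · obtain ⟨v, hvD, hvB⟩ := hne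
    have h1 : D ∩ B ⊆ insert v (D ∩ {u | G.Adj v u}) := by
      rintro u ⟨huD, huB⟩
      by_cases huv : u = v
      · exact Or.inl huv
      · exact Or.inr ⟨huD, hB hvB huB (Ne.symm huv)⟩
    have h2 := Set.ncard_le_ncard h1 (Set.toFinite _)
    have h3 := Set.ncard_insert_le v (D ∩ {u | G.Adj v u})
    have h4 := h v hvD
    omega
  · rw [Set.not_nonempty_iff_eq_empty.1 hne]; simp

end Diss

section Final

open Classical in
/-- Total weight of a vertex set. -/
noncomputable def wt [Fintype V] (x : V → ℝ) (S : Set V) : ℝ := ∑ v, if v ∈ S then x v else 0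

lemma wt_insert [Fintype V] (x : V → ℝ) (S : Set V) {w : V} (hw : w ∉ S) :
    wt x (insert w S) = wt x S + x w := by
  classical
  unfold wt
  have h : x w = ∑ v, if v = w then x v else 0 := by simp
  rw [h, ← Finset.sum_add_distrib]
  refine Finset.sum_congr rfl fun v _ => ?_
  by_cases hv : v = w
  · subst hv; simp [hw]
  · simp [hv]

lemma mv_agree (G : SimpleGraph V) (d : V → ℕ) (S : Set V) (w : V) (a b : V) (ha : a ≠ w)
    (hb : b ≠ w) : (mv G d S).Adj a b ↔ (mv G d (insert w S)).Adj a b := by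
  simp only [mv_adj, Set.mem_insert_iff, ha, hb, false_or]

lemma RS.nbr_clique {G : SimpleGraph V} {d : V → ℕ} (h : RS G d) {w : V} (hw : 0 < d w) :
    (insert w {y | G.Adj w y ∧ d y ≤ d w}).Pairwise G.Adj := by
  obtain ⟨p, hp, hlt, hu, hs⟩ := h.par w hw
  intro a ha b hb hab
  rcases ha with rfl | ⟨ha, had⟩ <;> rcases hb with rfl | ⟨hb, hbd⟩
  · exact (hab rfl).elim
  · exact hb
  · exact ha.symm
  · rcases lt_or_eq_of_le had with h1 | h1 <;> rcases lt_or_eq_of_le hbd with h2 | h2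
    · exact (hab ((hu a ha h1).trans (hu b hb h2).symm)).elim
    · rw [hu a ha h1]; exact (hs b hb h2).symm
    · rw [hu b hb h2]; exact hs a ha h1
    · exact h.sib w a b hw ha hb h1 h2 hab

lemma mv_step [Fintype V] {G : SimpleGraph V} {d : V → ℕ} (h : RS G d) {x : V → ℝ}
    (hx : ∀ v, 0 < x v) {K : Set V} (hK : ∀ v, d v = 0 ↔ v ∈ K)
    (hmax : ∀ C : Set V, C.Pairwise G.Adj → wt x C ≤ wt x K) {S : Set V} (hKS : K ⊆ S)
    {w : V} (hw : w ∉ S) : qf (mv G d S) x < qf (mv G d (insert w S)) x := by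
  classical
  have hdw : 0 < d w := Nat.pos_of_ne_zero fun h0 => hw (hKS ((hK w).1 h0))
  refine qf_lt w (hx w) (fun a b ha hb => mv_agree G d S w a b ha hb) ?_
  set C : Set V := {y | G.Adj w y ∧ d y ≤ d w} with hC
  have hwC : w ∉ C := fun h' => G.ne_of_adj h'.1 rfl
  have h1 := hmax _ (h.nbr_clique hdw)
  rw [wt_insert x C hwC] at h1
  have h2 := hx w
  have h3 : ∑ b, adjMat (mv G d S) w b * x b + wt x K ≤
      ∑ b, adjMat (mv G d (insert w S)) w b * x b + wt x C := by
    unfold wt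
    rw [← Finset.sum_add_distrib, ← Finset.sum_add_distrib]
    refine Finset.sum_le_sum fun b _ => ?_
    have hxb := hx b
    simp only [adjMat, Matrix.of_apply]
    by_cases hbw : b = w
    · subst hbw
      have : b ∉ K := fun h' => hw (hKS h')
      simp [hwC, this]
    have hwb : w ≠ b := Ne.symm hbw
    by_cases hbS : b ∈ S
    · have e1 : (mv G d (insert w S)).Adj w b := by
        rw [mv_adj]; exact ⟨hwb, Or.inl ⟨Set.mem_insert _ _, Set.mem_insert_of_mem _ hbS⟩⟩
      rw [if_pos e1]
      by_cases e2 : (mv G d S).Adj w b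
      · have e3 : b ∈ C := by
          rw [mv_adj] at e2
          have : G.Adj w b ∧ d b < d w := by tauto
          exact ⟨this.1, this.2.le⟩
        rw [if_pos e2, if_pos e3]
        split_ifs <;> linarith
      · rw [if_neg e2]
        split_ifs <;> linarith
    · have e1 : b ∉ K := fun h' => hbS (hKS h')
      rw [if_neg e1]
      by_cases e2 : (mv G d S).Adj w b
      · have e3 : G.Adj w b := by rw [mv_adj] at e2; tauto
        rw [if_pos e2]
        by_cases e4 : d w < d b
        · have e5 : (mv G d (insert w S)).Adj w b := by
            rw [mv_adj]
            have : b ∉ insert w S := by simp [hbw, hbS]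
            exact ⟨hwb, Or.inr (Or.inr (Or.inl ⟨Set.mem_insert _ _, this, e3, e4⟩))⟩
          rw [if_pos e5]
          split_ifs <;> linarith
        · have e5 : b ∈ C := ⟨e3, by omega⟩
          rw [if_pos e5]
          split_ifs <;> linarith
      · rw [if_neg e2]
        split_ifs <;> linarith
  linarith

lemma mv_mono [Fintype V] {G : SimpleGraph V} {d : V → ℕ} (h : RS G d) {x : V → ℝ}
    (hx : ∀ v, 0 < x v) {K : Set V} (hK : ∀ v, d v = 0 ↔ v ∈ K)
    (hmax : ∀ C : Set V, C.Pairwise G.Adj → wt x C ≤ wt x K) {S : Set V} (hKS : K ⊆ S)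
    (F : Finset V) : qf (mv G d S) x ≤ qf (mv G d (S ∪ F)) x := by
  classical
  induction F using Finset.induction_on with
  | empty => simp
  | insert a F ha ih =>
    by_cases haS : a ∈ S ∪ F
    · have : S ∪ ((insert a F : Finset V) : Set V) = S ∪ F := by
        rw [Finset.coe_insert, Set.union_insert, Set.insert_eq_of_mem haS]
      rw [this]; exact ih
    · rw [Finset.coe_insert, Set.union_insert]
      exact ih.trans (mv_step h hx hK hmax (hKS.trans Set.subset_union_left) haS).le

lemma main_aux [Fintype V] {G : SimpleGraph V} (hG : IsBlockGraph G)
    {B B' : Set V} (hB : IsBlock G B) (hB' : IsBlock G B')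
    (hBcard : 4 ≤ B.ncard) (hB'card : 4 ≤ B'.ncard) (hne : B ≠ B') :
    ∃ H : SimpleGraph V, IsBlockGraph H ∧ dissocNum H = dissocNum G ∧ specRad G < specRad H := by
  classical
  have hnon := hG.1.nonempty
  obtain ⟨x, hx, hqx⟩ := perron hG.1
  obtain ⟨K, hKc, hKmax⟩ := Set.exists_max_image {C : Set V | C.Pairwise G.Adj} (wt x)
    (Set.toFinite _) ⟨∅, by simp⟩
  have hKc' : K.Pairwise G.Adj := hKc
  have hmax : ∀ C : Set V, C.Pairwise G.Adj → wt x C ≤ wt x K := hKmax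
  have hKm : ∀ v, v ∉ K → ∃ s ∈ K, ¬ G.Adj v s := by
    intro v hv
    by_contra hcon
    push Not at hcon
    have h1 : (insert v K).Pairwise G.Adj := by
      refine hKc'.insert fun b hb _ => ⟨hcon b hb, (hcon b hb).symm⟩
    have h2 := hmax _ h1
    rw [wt_insert x K hv] at h2
    linarith [hx v]
  have hKne : K.Nonempty := by
    obtain ⟨v⟩ := hnon
    by_cases hv : v ∈ K
    · exact ⟨v, hv⟩
    · obtain ⟨s, hs, _⟩ := hKm v hv
      exact ⟨s, hs⟩
  have hRS := rs_of_block hG hKne hKc' hKm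
  have hK := dS_zero hG.1 hKne
  set d := dS G K with hd
  -- choose a large block different from `K`
  obtain ⟨C, hC, hCcard, hCK⟩ : ∃ C, IsBlock G C ∧ 4 ≤ C.ncard ∧ C ≠ K := by
    by_cases h : B = K
    · exact ⟨B', hB', hB'card, fun h' => hne (h.trans h'.symm)⟩
    · exact ⟨B, hB, hBcard, h⟩
  have hCc := hG.2 C hC
  obtain ⟨hCNS, hCmax⟩ := (isBlock_iff G C).1 hC
  obtain ⟨c1, hc1, c2, hc2, hc12⟩ := (Set.one_lt_ncard (Set.toFinite C)).1 (by omega)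
  have hCnot : ¬ C ⊆ K := fun hsub =>
    hCK (hCmax K hsub (clique_ns hKc' (hsub hc1) (hsub hc2) hc12))
  obtain ⟨z, hzC, hzK⟩ := Set.not_subset.1 hCnot
  obtain ⟨m, hmC, hm⟩ := Set.exists_max_image C d (Set.toFinite C) ⟨z, hzC⟩
  have hmpos : 0 < d m := by
    have h1 := hm z hzC
    have h2 : d z ≠ 0 := fun h => hzK ((hK z).1 h)
    omega
  obtain ⟨p, hp, hlt, hu, hs⟩ := hRS.par m hmpos
  have hCKp : ∀ y ∈ C, y ∈ K → y = p := by
    intro y hy hyK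
    have h0 := (hK y).2 hyK
    have : m ≠ y := by rintro rfl; omega
    exact hu y (hCc hmC hy this) (by omega)
  obtain ⟨D, hD, hDcard⟩ := dissoc_exists G
  obtain ⟨w, hwC, hwD, hwK⟩ : ∃ w ∈ C, w ∉ D ∧ w ∉ K := by
    by_contra hcon
    push Not at hcon
    have h1 : C ⊆ insert p (D ∩ C) := by
      intro y hy
      by_cases hyD : y ∈ D
      · exact Or.inr ⟨hyD, hy⟩
      · exact Or.inl (hCKp y hy (hcon y hy hyD))
    have h2 := Set.ncard_le_ncard h1 (Set.toFinite _)
    have h3 := Set.ncard_insert_le p (D ∩ C)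
    have h4 := dissoc_clique hD hCc
    omega
  have hmvK : mv G d K = G := by
    ext a b
    rw [mv_adj]
    have hab : G.Adj a b → a ≠ b := fun h => h.ne
    constructor
    · rintro ⟨h1, h2⟩
      rcases h2 with h2 | h2 | h2 | h2
      · exact hKc' h2.1 h2.2 h1
      · exact h2.2.2
      · exact h2.2.2.1
      · exact h2.2.2.1
    · intro h
      refine ⟨hab h, ?_⟩
      have ha := hK a
      have hb := hK b
      by_cases h1 : a ∈ K <;> by_cases h2 : b ∈ K
      · exact Or.inl ⟨h1, h2⟩
      · refine Or.inr (Or.inr (Or.inl ⟨h1, h2, h, ?_⟩))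
        rw [ha.2 h1]; exact Nat.pos_of_ne_zero fun h' => h2 (hb.1 h')
      · refine Or.inr (Or.inr (Or.inr ⟨h1, h2, h, ?_⟩))
        rw [hb.2 h2]; exact Nat.pos_of_ne_zero fun h' => h1 (ha.1 h')
      · exact Or.inr (Or.inl ⟨h1, h2, h⟩)
  set S0 : Set V := insert w K with hS0
  have hφ0 : dissocNum G ≤ dissocNum (mv G d S0) := by
    rw [← hDcard]
    refine dissoc_le (dissoc_of_agree (fun _ h => h) ?_ hD)
    intro a ha b hb hab
    rw [← hmvK]
    exact (mv_agree G d K w a b (fun h => hwD (h ▸ ha)) (fun h => hwD (h ▸ hb))).2 hab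
  obtain ⟨T, ⟨hT0, hTφ⟩, hTmax⟩ := Set.exists_max_image
    {T : Set V | S0 ⊆ T ∧ dissocNum G ≤ dissocNum (mv G d T)} Set.ncard (Set.toFinite _)
    ⟨S0, fun _ h => h, hφ0⟩
  have hTeq : dissocNum (mv G d T) = dissocNum G := by
    refine le_antisymm ?_ hTφ
    by_contra hgt
    push Not at hgt
    by_cases hTu : T = Set.univ
    · have hle : G ≤ mv G d T := by
        intro a b hab
        rw [mv_adj, hTu]
        exact ⟨hab.ne, Or.inl ⟨trivial, trivial⟩⟩
      have := dissocNum_anti hle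
      omega
    · obtain ⟨v, hv⟩ := (Set.ne_univ_iff_exists_notMem T).1 hTu
      have h1 := dissocNum_step v (fun a b ha hb => mv_agree G d T v a b ha hb)
      have h2 := hTmax (insert v T) ⟨hT0.trans (Set.subset_insert _ _), by omega⟩
      rw [Set.ncard_insert_of_notMem hv (Set.toFinite _)] at h2
      omega
  have hKT : K ⊆ T := (Set.subset_insert _ _).trans hT0
  refine ⟨mv G d T, ?_, hTeq, ?_⟩
  · obtain ⟨d', hd'⟩ := mv_rs hRS (S := T) (fun v hv => hKT ((hK v).1 hv))
    exact hd'.isBlockGraph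
  · refine specRad_lt hqx ?_
    have h1 := mv_step hRS hx hK hmax (fun _ h => h) hwK
    rw [hmvK] at h1
    have h2 := mv_mono hRS hx hK hmax (Set.subset_insert w K) T.toFinset
    rw [Set.coe_toFinset, Set.union_eq_self_of_subset_left hT0] at h2
    exact h1.trans_le h2

end Final

/-- A graph with maximal spectral radius in `Bl(k,φ)` has at most one block with
`4` or more vertices. -/
theorem at_most_one_big_block (k φ : ℕ) (G : SimpleGraph (Fin k)) (hG : MaxSpecIn k φ G)
    (B B' : Set (Fin k)) (hB : IsBlock G B) (hB' : IsBlock G B')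
    (hBcard : 4 ≤ B.ncard) (hB'card : 4 ≤ B'.ncard) :
    B = B' := by
  by_contra hne
  obtain ⟨H, hH, hφ, hlt⟩ := main_aux hG.1.1 hB hB' hBcard hB'card hne
  exact absurd (hG.2 H ⟨hH, hφ.trans hG.1.2⟩) (not_le.2 hlt)

end SpectralBlock
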